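/- Let d ≥ 1, m, n ≥ 3, and let x_1, …, x_m, y_1, …, y_n ∈ ℝ^d be m + n pairwise distinct points. Then (1/((m)_3 (n)_3)) Σ Σ h*_CvM(x_{i1}, x_{i2}, x_{i3}; y_{j1}, y_{j2}, y_{j3}) = (1/((m)_2 (n)_2)) Σ Σ h_CvM(x_{i1}, x_{i2}; y_{j1}, y_{j2}), where on the left the sums range over triples of pairwise distinct indices in {1,…,m} and in {1,…,n} respectively, on the right over pairs of distinct indices, and (k)_q = k(k−1)⋯(k−q+1). -/

import Mathlib

open MeasureTheory ProbabilityTheory Real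
open scoped RealInnerProductSpace ENNReal BigOperators

noncomputable section

/-- The standard Gaussian measure on `ℝ^d = EuclideanSpace ℝ (Fin d)`. -/
def stdGaussian (d : ℕ) : Measure (EuclideanSpace ℝ (Fin d)) :=
  (Measure.pi fun _ : Fin d => gaussianReal 0 1).map
    ⇑(EuclideanSpace.equiv (Fin d) ℝ).symm

/-- The uniform (rotation-invariant) probability measure `λ` on the unit sphere
`S^{d-1} = {x : ‖x‖ = 1} ⊆ ℝ^d`, realized as a Borel measure on `ℝ^d` concentrated
on the sphere: the pushforward of the standard Gaussian under `x ↦ ‖x‖⁻¹ • x`. -/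
def sphereUniform (d : ℕ) : Measure (EuclideanSpace ℝ (Fin d)) :=
  (stdGaussian d).map fun x => ‖x‖⁻¹ • x

/-- `Ang u v = arccos (⟪u,v⟫ / (‖u‖ ‖v‖)) ∈ [0, π]`, the angle between two nonzero vectors. -/
def Ang {d : ℕ} (u v : EuclideanSpace ℝ (Fin d)) : ℝ :=
  Real.arccos (⟪u, v⟫ / (‖u‖ * ‖v‖))

/-- The Cramér–von Mises kernel
`h_CvM(x₁,x₂;y₁,y₂) = 1/3 - Ang(x₁-y₁, x₂-y₁)/(2π) - Ang(y₁-x₁, y₂-x₁)/(2π)`. -/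
def hCvM {d : ℕ} (x1 x2 y1 y2 : EuclideanSpace ℝ (Fin d)) : ℝ :=
  1 / 3 - Ang (x1 - y1) (x2 - y1) / (2 * π) - Ang (y1 - x1) (y2 - x1) / (2 * π)

/-- The third-order Cramér–von Mises kernel `h*_CvM`. -/
def hStarCvM {d : ℕ} (x1 x2 x3 y1 y2 y3 : EuclideanSpace ℝ (Fin d)) : ℝ :=
  (1 / 2) * (∫ β,
      (((if ⟪β, x1⟫ ≤ ⟪β, x3⟫ then (1 : ℝ) else 0) - (if ⟪β, y1⟫ ≤ ⟪β, x3⟫ then (1 : ℝ) else 0))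
        * ((if ⟪β, x2⟫ ≤ ⟪β, x3⟫ then (1 : ℝ) else 0) - (if ⟪β, y2⟫ ≤ ⟪β, x3⟫ then (1 : ℝ) else 0)))
      ∂(sphereUniform d))
  + (1 / 2) * (∫ β,
      (((if ⟪β, x1⟫ ≤ ⟪β, y3⟫ then (1 : ℝ) else 0) - (if ⟪β, y1⟫ ≤ ⟪β, y3⟫ then (1 : ℝ) else 0))
        * ((if ⟪β, x2⟫ ≤ ⟪β, y3⟫ then (1 : ℝ) else 0) - (if ⟪β, y2⟫ ≤ ⟪β, y3⟫ then (1 : ℝ) else 0)))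
      ∂(sphereUniform d))


/-- Sum over triples of pairwise distinct indices. -/
def triSum (k : ℕ) (F : Fin k → Fin k → Fin k → ℝ) : ℝ :=
  ∑ p : Fin k × Fin k × Fin k with (p.1 ≠ p.2.1 ∧ p.1 ≠ p.2.2 ∧ p.2.1 ≠ p.2.2),
    F p.1 p.2.1 p.2.2

lemma triSum_swap12 (k : ℕ) (F : Fin k → Fin k → Fin k → ℝ) :
    triSum k (fun a b c => F b a c) = triSum k F := by
  unfold triSum
  refine Finset.sum_nbij' (fun p => (p.2.1, p.1, p.2.2)) (fun p => (p.2.1, p.1, p.2.2))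
    ?_ ?_ ?_ ?_ ?_ <;> simp <;> grind

lemma triSum_swap23 (k : ℕ) (F : Fin k → Fin k → Fin k → ℝ) :
    triSum k (fun a b c => F a c b) = triSum k F := by
  unfold triSum
  refine Finset.sum_nbij' (fun p => (p.1, p.2.2, p.2.1)) (fun p => (p.1, p.2.2, p.2.1))
    ?_ ?_ ?_ ?_ ?_ <;> simp <;> grind

lemma triSum_add (k : ℕ) (F G : Fin k → Fin k → Fin k → ℝ) :
    triSum k (fun a b c => F a b c + G a b c) = triSum k F + triSum k G := by
  unfold triSum
  exact Finset.sum_add_distrib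

lemma triSum_congr (k : ℕ) (F G : Fin k → Fin k → Fin k → ℝ)
    (h : ∀ a b c, a ≠ b → a ≠ c → b ≠ c → F a b c = G a b c) :
    triSum k F = triSum k G := by
  unfold triSum
  refine Finset.sum_congr rfl fun p hp => ?_
  simp only [Finset.mem_filter] at hp
  exact h _ _ _ hp.2.1 hp.2.2.1 hp.2.2.2

lemma triSum_comm (k l : ℕ)
    (F : Fin k → Fin k → Fin k → Fin l → Fin l → Fin l → ℝ) :
    triSum k (fun a b c => triSum l (F a b c))
      = triSum l (fun d e f => triSum k (fun a b c => F a b c d e f)) := by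
  unfold triSum
  exact Finset.sum_comm

lemma triSum_eq (k : ℕ) (F : Fin k → Fin k → Fin k → ℝ) :
    triSum k F = ∑ a, ∑ b, ∑ c, if (a ≠ b ∧ a ≠ c ∧ b ≠ c) then F a b c else 0 := by
  unfold triSum
  rw [Finset.sum_filter, Fintype.sum_prod_type]
  refine Finset.sum_congr rfl fun a _ => ?_
  rw [Fintype.sum_prod_type]

/-- If symmetrizations agree, so do the sums. -/
lemma triSum_congr_sym (k : ℕ) (F G : Fin k → Fin k → Fin k → ℝ)
    (h : ∀ a b c, a ≠ b → a ≠ c → b ≠ c →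
      F a b c + F b a c + F a c b + F c a b + F b c a + F c b a
        = G a b c + G b a c + G a c b + G c a b + G b c a + G c b a) :
    triSum k F = triSum k G := by
  have key : ∀ H : Fin k → Fin k → Fin k → ℝ, triSum k (fun a b c =>
      H a b c + H b a c + H a c b + H c a b + H b c a + H c b a) = 6 * triSum k H := by
    intro H
    have e2 := triSum_swap12 k H
    have e3 := triSum_swap23 k H
    have e4 := triSum_swap23 k (fun a b c => H b a c)
    have e5 := triSum_swap12 k (fun a b c => H a c b)
    have e6 := triSum_swap12 k (fun a b c => H c a b)
    simp only [triSum_add]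
    linarith
  have := triSum_congr k _ _ h
  rw [key, key] at this
  linarith

lemma triSum_last (k : ℕ) (F : Fin k → Fin k → ℝ) :
    triSum k (fun a b _ => F a b)
      = ((k : ℝ) - 2) * ∑ a, ∑ b, if a ≠ b then F a b else 0 := by
  rw [triSum_eq, Finset.mul_sum]
  refine Finset.sum_congr rfl fun a _ => ?_
  rw [Finset.mul_sum]
  refine Finset.sum_congr rfl fun b _ => ?_
  by_cases hab : a = b
  · simp [hab]
  · rw [← Finset.sum_filter]
    have hs : (Finset.univ.filter fun c => a ≠ b ∧ a ≠ c ∧ b ≠ c)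
        = ((Finset.univ : Finset (Fin k)).erase a).erase b := by
      ext c; simp; grind
    rw [hs, Finset.sum_const, Finset.card_erase_of_mem (by simp; grind),
      Finset.card_erase_of_mem (by simp)]
    have hk : 2 ≤ k := by
      have := a.2; have := b.2
      have : (a : ℕ) ≠ b := fun h => hab (Fin.ext h)
      omega
    simp only [Finset.card_univ, Fintype.card_fin, nsmul_eq_mul, ne_eq, hab, not_false_eq_true,
      if_true]
    congr 1
    rw [Nat.sub_sub]; push_cast [Nat.cast_sub hk]; ring

/-- The combinatorial heart. -/
lemma comb_main {α : Type*} (m n : ℕ) (Q : α → α → α → ℝ) (x : Fin m → α) (y : Fin n → α)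
    (hx : Function.Injective x) (hy : Function.Injective y) (hxy : ∀ i j, x i ≠ y j)
    (hsym : ∀ a b c, Q a b c = Q a c b)
    (htri : ∀ a b c, a ≠ b → a ≠ c → b ≠ c → Q a b c + Q b a c + Q c a b = 1) :
    triSum m (fun i1 i2 i3 => triSum n (fun j1 j2 j3 =>
      (1 / 2) * (Q (x i3) (x i1) (x i2) - Q (x i3) (x i1) (y j2) - Q (x i3) (y j1) (x i2)
        + Q (x i3) (y j1) (y j2)) +
      (1 / 2) * (Q (y j3) (x i1) (x i2) - Q (y j3) (x i1) (y j2) - Q (y j3) (y j1) (x i2)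
        + Q (y j3) (y j1) (y j2))))
    = triSum m (fun i1 i2 _ => triSum n (fun j1 j2 _ =>
        Q (y j1) (x i1) (x i2) + Q (x i1) (y j1) (y j2) - 2 / 3)) := by
  trans triSum m (fun i1 i2 _ => triSum n (fun j1 j2 j3 =>
      (1 / 2) * (1 / 3 - (1 / 2) * (1 - Q (y j1) (x i1) (x i2))
        - (1 / 2) * (1 - Q (y j2) (x i1) (x i2)) + Q (x i1) (y j1) (y j2)) +
      (1 / 2) * (Q (y j3) (x i1) (x i2) - Q (y j3) (x i1) (y j2) - Q (y j3) (y j1) (x i1)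
        + Q (y j3) (y j1) (y j2))))
  · rw [triSum_comm, triSum_comm m n]
    refine triSum_congr _ _ _ fun j1 j2 j3 _ _ _ => ?_
    refine triSum_congr_sym _ _ _ fun a b c hab hac hbc => ?_
    have nab := hx.ne hab
    have nac := hx.ne hac
    have nbc := hx.ne hbc
    have t0 := htri _ _ _ nab nac nbc
    have t1 := fun j => htri _ _ (y j) nab (hxy a j) (hxy b j)
    have t2 := fun j => htri _ _ (y j) nac (hxy a j) (hxy c j)
    have t3 := fun j => htri _ _ (y j) nbc (hxy b j) (hxy c j)
    have s1 := t1 j1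
    have s2 := t1 j2
    have s3 := t2 j1
    have s4 := t2 j2
    have s5 := t3 j1
    have s6 := t3 j2
    clear t1 t2 t3
    generalize x a = A at *
    generalize x b = B at *
    generalize x c = C at *
    generalize y j1 = D at *
    generalize y j2 = E at *
    generalize y j3 = F at *
    rw [hsym A C B, hsym B C A, hsym C B A, hsym A D B, hsym A D C, hsym B D A, hsym B D C,
      hsym C D A, hsym C D B, hsym D B A, hsym D C A, hsym D C B, hsym E B A, hsym E C A,
      hsym E C B, hsym F B A, hsym F C A, hsym F C B]
    linarith
  · refine triSum_congr _ _ _ fun i1 i2 i3 h12 _ _ => ?_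
    refine triSum_congr_sym _ _ _ fun a b c hab hac hbc => ?_
    have nab := hy.ne hab
    have nac := hy.ne hac
    have nbc := hy.ne hbc
    have t0 := htri _ _ _ nab nac nbc
    have s1 := htri _ _ _ (hxy i1 a) (hxy i1 b) nab
    have s2 := htri _ _ _ (hxy i1 a) (hxy i1 c) nac
    have s3 := htri _ _ _ (hxy i1 b) (hxy i1 c) nbc
    generalize y a = A at *
    generalize y b = B at *
    generalize y c = C at *
    generalize x i1 = D at *
    generalize x i2 = E at *
    rw [hsym A C B, hsym B C A, hsym C B A, hsym A B D, hsym A C D, hsym B A D, hsym B C D,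
      hsym C A D, hsym C B D, hsym D B A, hsym D C A, hsym D C B]
    linarith

/-- The planar standard Gaussian measure. -/
def planeGaussian : Measure (ℝ × ℝ) := (gaussianReal 0 1).prod (gaussianReal 0 1)

instance : IsProbabilityMeasure planeGaussian := by unfold planeGaussian; infer_instance

lemma stdGaussian_eq (d : ℕ) :
    _root_.stdGaussian d = ProbabilityTheory.stdGaussian (EuclideanSpace ℝ (Fin d)) := by
  rw [← map_pi_eq_stdGaussian]
  rfl

instance (d : ℕ) : IsProbabilityMeasure (_root_.stdGaussian d) := by
  rw [stdGaussian_eq]; infer_instance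

lemma measurable_normalize (d : ℕ) :
    Measurable (fun x : EuclideanSpace ℝ (Fin d) => ‖x‖⁻¹ • x) := by fun_prop

instance (d : ℕ) : IsProbabilityMeasure (sphereUniform d) := by
  unfold sphereUniform
  exact Measure.isProbabilityMeasure_map (measurable_normalize d).aemeasurable

/-- Law of a pair of linear functionals with unit coefficient vectors. -/
lemma map_pair {d : ℕ} (u v : EuclideanSpace ℝ (Fin d)) (θ : ℝ) (hu : ‖u‖ = 1) (hv : ‖v‖ = 1)
    (huv : ⟪u, v⟫ = cos θ) :
    (ProbabilityTheory.stdGaussian (EuclideanSpace ℝ (Fin d))).map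
        (fun x => ((⟪u, x⟫, ⟪v, x⟫) : ℝ × ℝ))
      = planeGaussian.map (fun p => (p.1, cos θ * p.1 + sin θ * p.2)) := by
  let L1 : EuclideanSpace ℝ (Fin d) →L[ℝ] ℝ × ℝ := (innerSL ℝ u).prod (innerSL ℝ v)
  let L2 : ℝ × ℝ →L[ℝ] ℝ × ℝ := (ContinuousLinearMap.fst ℝ ℝ ℝ).prod
    (cos θ • ContinuousLinearMap.fst ℝ ℝ ℝ + sin θ • ContinuousLinearMap.snd ℝ ℝ ℝ)
  have h1 : (fun x => ((⟪u, x⟫, ⟪v, x⟫) : ℝ × ℝ)) = L1 := by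
    ext x <;> simp [L1]
  have h2 : (fun p : ℝ × ℝ => (p.1, cos θ * p.1 + sin θ * p.2)) = L2 := by
    ext x <;> simp [L2]
  rw [h1, h2]
  have : IsFiniteMeasure ((ProbabilityTheory.stdGaussian (EuclideanSpace ℝ (Fin d))).map L1) :=
    inferInstance
  have : IsFiniteMeasure (planeGaussian.map L2) := inferInstance
  apply Measure.ext_of_charFunDual
  ext L
  rw [charFunDual_map, charFunDual_map, charFunDual_stdGaussian]
  have hL : ∀ p : ℝ × ℝ, L p = p.1 * L (1, 0) + p.2 * L (0, 1) := by
    intro p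
    have : p = p.1 • ((1, 0) : ℝ × ℝ) + p.2 • ((0, 1) : ℝ × ℝ) := by
      ext <;> simp
    conv_lhs => rw [this]
    rw [map_add, map_smul, map_smul, smul_eq_mul, smul_eq_mul]
  set a := L (1, 0) with ha
  set b := L (0, 1) with hb
  have e1 : L.comp L1 = innerSL ℝ (a • u + b • v) := by
    ext x
    simp only [ContinuousLinearMap.comp_apply, innerSL_apply_apply]
    rw [hL]
    simp [L1, inner_add_left, inner_smul_left]
    ring
  have nrm : ‖a • u + b • v‖ ^ 2 = a ^ 2 + 2 * (a * b * cos θ) + b ^ 2 := by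
    rw [norm_add_sq_real, norm_smul, norm_smul, hu, hv, inner_smul_left, inner_smul_right, huv]
    simp
    ring
  rw [e1, innerSL_apply_norm]
  have hch : ∀ (M : ℝ →L[ℝ] ℝ), charFunDual (gaussianReal 0 1) M
      = Complex.exp (-((M 1 : ℝ) : ℂ) ^ 2 / 2) := by
    intro M
    have hM : ∀ x : ℝ, M x = M 1 * x := by
      intro x
      have := M.map_smul x 1
      simp only [smul_eq_mul, mul_one] at this
      rw [this, mul_comm]
    have hc : charFunDual (gaussianReal 0 1) M = charFun (gaussianReal 0 1) (M 1) := by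
      rw [charFunDual_apply, charFun_apply_real]
      refine integral_congr_ae (Filter.Eventually.of_forall fun x => ?_)
      change Complex.exp (((M x : ℝ) : ℂ) * Complex.I) = _
      rw [hM x, Complex.ofReal_mul]
    rw [hc, charFun_gaussianReal]
    simp [neg_div]
  rw [planeGaussian, charFunDual_prod, hch, hch, ← Complex.exp_add]
  congr 1
  have f1 : ((L.comp L2).comp (ContinuousLinearMap.inl ℝ ℝ ℝ)) 1 = a + b * cos θ := by
    simp only [ContinuousLinearMap.comp_apply]
    rw [hL]; simp [L2]; ring
  have f2 : ((L.comp L2).comp (ContinuousLinearMap.inr ℝ ℝ ℝ)) 1 = b * sin θ := by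
    simp only [ContinuousLinearMap.comp_apply]
    rw [hL]; simp [L2]; ring
  rw [f1, f2, ← Complex.ofReal_pow, nrm]
  norm_cast
  have := sin_sq_add_cos_sq θ
  linear_combination (b ^ 2 / 2) * this

/-- Planar Gaussian measure of a cone, via polar coordinates. -/
lemma plane_cone (S : Set (ℝ × ℝ)) (hS : MeasurableSet S) (A : Set ℝ) (hA : MeasurableSet A)
    (h : ∀ r : ℝ, 0 < r → ∀ φ : ℝ, (r * cos φ, r * sin φ) ∈ S ↔ φ ∈ A) :
    planeGaussian S = (∫⁻ r in Set.Ioi (0 : ℝ),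
        ENNReal.ofReal r * ENNReal.ofReal ((2 * π)⁻¹ * exp (-r ^ 2 / 2)))
      * volume (A ∩ Set.Ioo (-π) π) := by
  have hpg : planeGaussian = volume.withDensity
      (fun p : ℝ × ℝ => ENNReal.ofReal ((2 * π)⁻¹ * exp (-(p.1 ^ 2 + p.2 ^ 2) / 2))) := by
    unfold planeGaussian
    rw [gaussianReal_of_var_ne_zero _ one_ne_zero,
      prod_withDensity (measurable_gaussianPDF _ _) (measurable_gaussianPDF _ _)]
    congr 1
    ext p
    simp only [gaussianPDF, gaussianPDFReal]
    rw [← ENNReal.ofReal_mul (by positivity)]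
    congr 1
    have e : exp (-(p.1 ^ 2 + p.2 ^ 2) / 2) = exp (-p.1 ^ 2 / 2) * exp (-p.2 ^ 2 / 2) := by
      rw [← Real.exp_add]; congr 1; ring
    have e2 : (2 * π)⁻¹ = (√(2 * π))⁻¹ * (√(2 * π))⁻¹ := by
      rw [← mul_inv, Real.mul_self_sqrt (by positivity)]
    rw [e, e2]
    simp
    ring
  rw [hpg, withDensity_apply _ hS, ← lintegral_indicator hS, ← lintegral_comp_polarCoord_symm]
  have ht : polarCoord.target = Set.Ioi (0 : ℝ) ×ˢ Set.Ioo (-π) π := rfl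
  rw [ht, Measure.volume_eq_prod, ← Measure.prod_restrict]
  have hvol : volume (A ∩ Set.Ioo (-π) π)
      = ∫⁻ φ in Set.Ioo (-π) π, A.indicator (fun _ => 1) φ := by
    change _ = ∫⁻ φ in Set.Ioo (-π) π, A.indicator 1 φ
    rw [lintegral_indicator_one hA, Measure.restrict_apply hA]
  rw [hvol, ← lintegral_prod_mul (by fun_prop)
    ((measurable_const.indicator hA).aemeasurable), Measure.prod_restrict]
  refine setLIntegral_congr_fun (measurableSet_Ioi.prod measurableSet_Ioo) ?_
  rintro ⟨r, φ⟩ ⟨hr, hφ⟩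
  have hr' : 0 < r := hr
  have hsq : (r * cos φ) ^ 2 + (r * sin φ) ^ 2 = r ^ 2 := by
    have := sin_sq_add_cos_sq φ
    linear_combination r ^ 2 * this
  by_cases hm : φ ∈ A
  · have : (r * cos φ, r * sin φ) ∈ S := (h r hr' φ).2 hm
    have hval : polarCoord.symm (r, φ) = (r * cos φ, r * sin φ) := rfl
    change ENNReal.ofReal r • S.indicator _ (polarCoord.symm (r, φ)) = _
    rw [hval, Set.indicator_of_mem this]
    beta_reduce
    rw [Set.indicator_of_mem hm]
    change ENNReal.ofReal r * ENNReal.ofReal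
      ((2 * π)⁻¹ * exp (-((r * cos φ) ^ 2 + (r * sin φ) ^ 2) / 2)) = _
    rw [hsq, mul_one]
  · have : (r * cos φ, r * sin φ) ∉ S := fun hh => hm ((h r hr' φ).1 hh)
    simp [polarCoord, this, hm]

lemma plane_wedge (θ : ℝ) (h0 : 0 ≤ θ) (h1 : θ ≤ π) :
    planeGaussian {p | p.1 ≤ 0 ∧ cos θ * p.1 + sin θ * p.2 ≤ 0}
      = ENNReal.ofReal (1 / 2 - θ / (2 * π)) := by
  have hsymm : planeGaussian {p | p.1 ≤ 0 ∧ cos θ * p.1 + sin θ * p.2 ≤ 0}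
      = planeGaussian {p | 0 ≤ p.1 ∧ 0 ≤ cos θ * p.1 + sin θ * p.2} := by
    have hn : (gaussianReal 0 1).map (fun x => -x) = gaussianReal 0 1 := by
      rw [gaussianReal_map_neg]; simp
    have : planeGaussian.map (Prod.map (fun x : ℝ => -x) (fun x : ℝ => -x)) = planeGaussian := by
      unfold planeGaussian
      rw [← Measure.map_prod_map _ _ measurable_neg measurable_neg, hn]
    conv_lhs => rw [← this]
    rw [Measure.map_apply (by fun_prop) (by measurability)]
    congr 1
    ext p
    simp only [Set.mem_preimage, Set.mem_ofPred_eq, Prod.map]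
    constructor <;> rintro ⟨h, h'⟩ <;> constructor <;> linarith
  rw [hsymm]
  have hC := plane_cone Set.univ MeasurableSet.univ Set.univ MeasurableSet.univ (by simp)
  rw [measure_univ, Set.univ_inter, Real.volume_Ioo] at hC
  set C := (∫⁻ r in Set.Ioi (0 : ℝ),
        ENNReal.ofReal r * ENNReal.ofReal ((2 * π)⁻¹ * exp (-r ^ 2 / 2))) with hCdef
  have hpi := Real.pi_pos
  have hC' : C = ENNReal.ofReal (1 / (2 * π)) := by
    rw [ENNReal.ofReal_div_of_pos (by positivity), ENNReal.ofReal_one,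
      show 2 * π = π - -π by ring]
    rw [ENNReal.eq_div_iff (by simp [hpi]) ENNReal.ofReal_ne_top, mul_comm]
    exact hC.symm
  rw [plane_cone _ (by measurability) {φ | 0 ≤ cos φ ∧ 0 ≤ cos (φ - θ)} (by measurability),
    ← hCdef, hC']
  · have : ({φ | 0 ≤ cos φ ∧ 0 ≤ cos (φ - θ)} ∩ Set.Ioo (-π) π : Set ℝ)
        =ᵐ[volume] Set.Ioo (θ - π / 2) (π / 2) := by
      have hne : ∀ z : ℝ, ∀ᵐ φ : ℝ ∂volume, φ ≠ z := fun z => Measure.ae_ne volume z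
      filter_upwards [hne (π / 2), hne (-(π / 2)), hne (θ - π / 2)] with φ n1 n2 n3
      apply propext
      change ((0 ≤ cos φ ∧ 0 ≤ cos (φ - θ)) ∧ φ ∈ Set.Ioo (-π) π) ↔ φ ∈ Set.Ioo (θ - π / 2) (π / 2)
      constructor
      · rintro ⟨⟨c1, c2⟩, ⟨l, r⟩⟩
        have k1 : φ < π / 2 := by
          by_contra hcon
          have hlt : π / 2 < φ := lt_of_le_of_ne (not_lt.1 hcon) (Ne.symm n1)
          have := cos_neg_of_pi_div_two_lt_of_lt hlt (by linarith)
          linarith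
        have k2 : -(π / 2) < φ := by
          by_contra hcon
          have hlt : φ < -(π / 2) := lt_of_le_of_ne (not_lt.1 hcon) n2
          have := cos_neg_of_pi_div_two_lt_of_lt (x := -φ) (by linarith) (by linarith)
          rw [cos_neg] at this
          linarith
        refine ⟨?_, k1⟩
        by_contra hcon
        have hlt : φ < θ - π / 2 := lt_of_le_of_ne (not_lt.1 hcon) n3
        have := cos_neg_of_pi_div_two_lt_of_lt (x := -(φ - θ)) (by linarith) (by linarith)
        rw [cos_neg] at this
        linarith
      · rintro ⟨l, r⟩
        refine ⟨⟨?_, ?_⟩, by linarith, by linarith⟩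
        · exact cos_nonneg_of_neg_pi_div_two_le_of_le (by linarith) (by linarith)
        · exact cos_nonneg_of_neg_pi_div_two_le_of_le (by linarith) (by linarith)
    rw [measure_congr this, Real.volume_Ioo, ← ENNReal.ofReal_mul (by positivity)]
    congr 1
    field_simp
    ring
  · intro r hr φ
    simp only [Set.mem_ofPred_eq]
    rw [cos_sub, show cos θ * (r * cos φ) + sin θ * (r * sin φ)
      = r * (cos φ * cos θ + sin φ * sin θ) by ring, mul_nonneg_iff_of_pos_left hr,
      mul_nonneg_iff_of_pos_left hr]

lemma orthant {d : ℕ} (u v : EuclideanSpace ℝ (Fin d)) (hu : u ≠ 0) (hv : v ≠ 0) :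
    sphereUniform d {β | ⟪β, u⟫ ≤ 0 ∧ ⟪β, v⟫ ≤ 0}
      = ENNReal.ofReal (1 / 2 - Ang u v / (2 * π)) := by
  have hu' : 0 < ‖u‖ := norm_pos_iff.2 hu
  have hv' : 0 < ‖v‖ := norm_pos_iff.2 hv
  have hang : cos (Ang u v) = ⟪‖u‖⁻¹ • u, ‖v‖⁻¹ • v⟫ := by
    have := InnerProductGeometry.cos_angle u v
    unfold Ang
    rw [InnerProductGeometry.angle] at this
    rw [this, inner_smul_left, inner_smul_right]
    simp
    field_simp
  rw [← plane_wedge (Ang u v) (arccos_nonneg _) (arccos_le_pi _)]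
  have hmp := map_pair (‖u‖⁻¹ • u) (‖v‖⁻¹ • v) (Ang u v) (by simp [norm_smul, hu'.ne'])
    (by simp [norm_smul, hv'.ne']) hang.symm
  have hset : MeasurableSet {p : ℝ × ℝ | p.1 ≤ 0 ∧ p.2 ≤ 0} := by measurability
  have := congrArg (fun μ => μ {p : ℝ × ℝ | p.1 ≤ 0 ∧ p.2 ≤ 0}) hmp
  simp only at this
  rw [Measure.map_apply (by fun_prop) hset, Measure.map_apply (by fun_prop) hset] at this
  rw [sphereUniform, Measure.map_apply (measurable_normalize d) (by measurability),
    stdGaussian_eq]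
  refine Eq.trans ?_ this
  congr 1
  ext x
  have hsc : ∀ w : EuclideanSpace ℝ (Fin d), w ≠ 0 →
      (⟪‖x‖⁻¹ • x, w⟫ ≤ 0 ↔ ⟪‖w‖⁻¹ • w, x⟫ ≤ 0) := by
    intro w hw
    have hw' : 0 < ‖w‖⁻¹ := inv_pos.2 (norm_pos_iff.2 hw)
    rw [real_inner_smul_left, real_inner_smul_left, real_inner_comm]
    by_cases hx : x = 0
    · simp [hx]
    have hx' : 0 < ‖x‖⁻¹ := inv_pos.2 (norm_pos_iff.2 hx)
    have aux : ∀ t s : ℝ, 0 < t → (t * s ≤ 0 ↔ s ≤ 0) := fun t s ht =>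
      ⟨fun h => by by_contra hc; nlinarith, fun h => mul_nonpos_of_nonneg_of_nonpos ht.le h⟩
    rw [aux _ _ hx', aux _ _ hw']
  exact and_congr (hsc u hu) (hsc v hv)

/-- Orthant probability expressed through the angle. -/
def orthP {d : ℕ} (a b c : EuclideanSpace ℝ (Fin d)) : ℝ :=
  1 / 2 - Ang (b - a) (c - a) / (2 * π)

/-- The indicator that the projection of `b` is at most that of `a`. -/
def indLe {d : ℕ} (b a β : EuclideanSpace ℝ (Fin d)) : ℝ :=
  if ⟪β, b⟫ ≤ ⟪β, a⟫ then (1 : ℝ) else 0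

lemma indLe_mul {d : ℕ} (a b c : EuclideanSpace ℝ (Fin d)) :
    (fun β => indLe b a β * indLe c a β)
      = Set.indicator {β | ⟪β, b - a⟫ ≤ 0 ∧ ⟪β, c - a⟫ ≤ 0} (fun _ => (1 : ℝ)) := by
  ext β
  simp only [indLe, Set.indicator_apply, Set.mem_ofPred_eq, inner_sub_right, sub_nonpos]
  by_cases h1 : ⟪β, b⟫ ≤ ⟪β, a⟫ <;> by_cases h2 : ⟪β, c⟫ ≤ ⟪β, a⟫ <;> simp [h1, h2]

lemma measurableSet_orth {d : ℕ} (u v : EuclideanSpace ℝ (Fin d)) :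
    MeasurableSet {β : EuclideanSpace ℝ (Fin d) | ⟪β, u⟫ ≤ 0 ∧ ⟪β, v⟫ ≤ 0} := by
  measurability

lemma indLe_integrable {d : ℕ} (a b c : EuclideanSpace ℝ (Fin d)) :
    Integrable (fun β => indLe b a β * indLe c a β) (sphereUniform d) := by
  rw [indLe_mul]
  exact (integrable_const _).indicator (measurableSet_orth _ _)

lemma indLe_integral {d : ℕ} (a b c : EuclideanSpace ℝ (Fin d)) (hb : b ≠ a) (hc : c ≠ a) :
    ∫ β, indLe b a β * indLe c a β ∂(sphereUniform d) = orthP a b c := by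
  rw [indLe_mul, integral_indicator_const _ (measurableSet_orth _ _), measureReal_def,
    orthant _ _ (sub_ne_zero.2 hb) (sub_ne_zero.2 hc), ENNReal.toReal_ofReal]
  · simp [orthP]
  · have : Ang (b - a) (c - a) ≤ π := arccos_le_pi _
    have hpi := Real.pi_pos
    rw [sub_nonneg, div_le_div_iff₀ (by positivity) (by positivity)]
    linarith

lemma four_integral {d : ℕ} (a x1 x2 y1 y2 : EuclideanSpace ℝ (Fin d))
    (h1 : x1 ≠ a) (h2 : x2 ≠ a) (h3 : y1 ≠ a) (h4 : y2 ≠ a) :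
    ∫ β, ((indLe x1 a β - indLe y1 a β) * (indLe x2 a β - indLe y2 a β)) ∂(sphereUniform d)
      = orthP a x1 x2 - orthP a x1 y2 - orthP a y1 x2 + orthP a y1 y2 := by
  have e : ∀ β, (indLe x1 a β - indLe y1 a β) * (indLe x2 a β - indLe y2 a β)
      = indLe x1 a β * indLe x2 a β - indLe x1 a β * indLe y2 a β
        - indLe y1 a β * indLe x2 a β + indLe y1 a β * indLe y2 a β := fun β => by ring
  simp_rw [e]
  have i1 := indLe_integrable a x1 x2
  have i2 := indLe_integrable a x1 y2
  have i3 := indLe_integrable a y1 x2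
  have i4 := indLe_integrable a y1 y2
  have i12 : Integrable (fun β => indLe x1 a β * indLe x2 a β - indLe x1 a β * indLe y2 a β)
      (sphereUniform d) := i1.sub i2
  have i123 : Integrable (fun β => indLe x1 a β * indLe x2 a β - indLe x1 a β * indLe y2 a β
      - indLe y1 a β * indLe x2 a β) (sphereUniform d) := i12.sub i3
  rw [integral_add i123 i4, integral_sub i12 i3, integral_sub i1 i2,
    indLe_integral _ _ _ h1 h2, indLe_integral _ _ _ h1 h4, indLe_integral _ _ _ h3 h2,
    indLe_integral _ _ _ h3 h4]

lemma hStar_eq {d : ℕ} (x1 x2 x3 y1 y2 y3 : EuclideanSpace ℝ (Fin d))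
    (h1 : x1 ≠ x3) (h2 : x2 ≠ x3) (h3 : y1 ≠ x3) (h4 : y2 ≠ x3)
    (h5 : x1 ≠ y3) (h6 : x2 ≠ y3) (h7 : y1 ≠ y3) (h8 : y2 ≠ y3) :
    hStarCvM x1 x2 x3 y1 y2 y3 =
      (1 / 2) * (orthP x3 x1 x2 - orthP x3 x1 y2 - orthP x3 y1 x2 + orthP x3 y1 y2)
      + (1 / 2) * (orthP y3 x1 x2 - orthP y3 x1 y2 - orthP y3 y1 x2 + orthP y3 y1 y2) := by
  rw [← four_integral x3 x1 x2 y1 y2 h1 h2 h3 h4, ← four_integral y3 x1 x2 y1 y2 h5 h6 h7 h8]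
  rfl

lemma Ang_comm {d : ℕ} (u v : EuclideanSpace ℝ (Fin d)) : Ang u v = Ang v u :=
  InnerProductGeometry.angle_comm u v

lemma orthP_symm {d : ℕ} (a b c : EuclideanSpace ℝ (Fin d)) : orthP a b c = orthP a c b := by
  rw [orthP, orthP, Ang_comm]

lemma orthP_tri {d : ℕ} (a b c : EuclideanSpace ℝ (Fin d)) (hab : a ≠ b) :
    orthP a b c + orthP b a c + orthP c a b = 1 := by
  have h := EuclideanGeometry.angle_add_angle_add_angle_eq_pi c hab
  change Ang (b - a) (c - a) + Ang (a - c) (b - c) + Ang (c - b) (a - b) = π at h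
  rw [Ang_comm (c - b)] at h
  have hpi := Real.pi_pos
  unfold orthP
  field_simp
  linarith

lemma hCvM_eq {d : ℕ} (x1 x2 y1 y2 : EuclideanSpace ℝ (Fin d)) :
    hCvM x1 x2 y1 y2 = orthP y1 x1 x2 + orthP x1 y1 y2 - 2 / 3 := by
  unfold hCvM orthP
  ring

/-- Lemma: two expressions for the CvM statistic: for `m+n` pairwise
distinct points `x₁,…,x_m, y₁,…,y_n ∈ ℝ^d` (`d ≥ 1`, `m, n ≥ 3`), the third-order
`U`-statistic with kernel `h*_CvM` equals the second-order `U`-statistic with kernel `h_CvM`. -/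
theorem stmt10 {d m n : ℕ} (hd : 1 ≤ d) (hm : 3 ≤ m) (hn : 3 ≤ n)
    (x : Fin m → EuclideanSpace ℝ (Fin d)) (y : Fin n → EuclideanSpace ℝ (Fin d))
    (hx : Function.Injective x) (hy : Function.Injective y)
    (hxy : ∀ i j, x i ≠ y j) :
    ((m : ℝ) * ((m : ℝ) - 1) * ((m : ℝ) - 2) * ((n : ℝ) * ((n : ℝ) - 1) * ((n : ℝ) - 2)))⁻¹ *
        ∑ i1 : Fin m, ∑ i2 : Fin m, ∑ i3 : Fin m, ∑ j1 : Fin n, ∑ j2 : Fin n, ∑ j3 : Fin n,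
          (if i1 ≠ i2 ∧ i1 ≠ i3 ∧ i2 ≠ i3 ∧ j1 ≠ j2 ∧ j1 ≠ j3 ∧ j2 ≠ j3 then
            hStarCvM (x i1) (x i2) (x i3) (y j1) (y j2) (y j3)
          else 0)
      = ((m : ℝ) * ((m : ℝ) - 1) * ((n : ℝ) * ((n : ℝ) - 1)))⁻¹ *
          ∑ i1 : Fin m, ∑ i2 : Fin m, ∑ j1 : Fin n, ∑ j2 : Fin n,
            (if i1 ≠ i2 ∧ j1 ≠ j2 then hCvM (x i1) (x i2) (y j1) (y j2) else 0) := by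

  have hL : (∑ i1 : Fin m, ∑ i2 : Fin m, ∑ i3 : Fin m, ∑ j1 : Fin n, ∑ j2 : Fin n, ∑ j3 : Fin n,
          (if i1 ≠ i2 ∧ i1 ≠ i3 ∧ i2 ≠ i3 ∧ j1 ≠ j2 ∧ j1 ≠ j3 ∧ j2 ≠ j3 then
            hStarCvM (x i1) (x i2) (x i3) (y j1) (y j2) (y j3)
          else 0))
      = triSum m (fun i1 i2 i3 => triSum n (fun j1 j2 j3 =>
          hStarCvM (x i1) (x i2) (x i3) (y j1) (y j2) (y j3))) := by
    rw [triSum_eq]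
    refine Finset.sum_congr rfl fun i1 _ => Finset.sum_congr rfl fun i2 _ =>
      Finset.sum_congr rfl fun i3 _ => ?_
    rw [triSum_eq]
    by_cases h : i1 ≠ i2 ∧ i1 ≠ i3 ∧ i2 ≠ i3
    · rw [if_pos h]
      obtain ⟨a, b, c⟩ := h
      simp only [ne_eq, a, b, c, not_false_eq_true, true_and]
    · rw [if_neg h]
      refine Finset.sum_eq_zero fun j1 _ => Finset.sum_eq_zero fun j2 _ =>
        Finset.sum_eq_zero fun j3 _ => if_neg fun hh => h ⟨hh.1, hh.2.1, hh.2.2.1⟩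
  have hR : (∑ i1 : Fin m, ∑ i2 : Fin m, ∑ j1 : Fin n, ∑ j2 : Fin n,
            (if i1 ≠ i2 ∧ j1 ≠ j2 then hCvM (x i1) (x i2) (y j1) (y j2) else 0))
      = ∑ i1 : Fin m, ∑ i2 : Fin m, if i1 ≠ i2 then (∑ j1 : Fin n, ∑ j2 : Fin n,
            if j1 ≠ j2 then hCvM (x i1) (x i2) (y j1) (y j2) else 0) else 0 := by
    refine Finset.sum_congr rfl fun i1 _ => Finset.sum_congr rfl fun i2 _ => ?_
    by_cases h : i1 = i2 <;> simp [h]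
  have hS : triSum m (fun i1 i2 i3 => triSum n (fun j1 j2 j3 =>
          hStarCvM (x i1) (x i2) (x i3) (y j1) (y j2) (y j3)))
      = triSum m (fun i1 i2 _ => triSum n (fun j1 j2 _ =>
          hCvM (x i1) (x i2) (y j1) (y j2))) := by
    simp_rw [hCvM_eq]
    rw [← comb_main m n orthP x y hx hy hxy orthP_symm (fun a b c h _ _ => orthP_tri a b c h)]
    refine triSum_congr _ _ _ fun i1 i2 i3 _ h13 h23 => ?_
    refine triSum_congr _ _ _ fun j1 j2 j3 _ g13 g23 => ?_
    exact hStar_eq _ _ _ _ _ _ (hx.ne h13) (hx.ne h23) (hxy _ _).symm (hxy _ _).symm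
      (hxy _ _) (hxy _ _) (hy.ne g13) (hy.ne g23)
  rw [hL, hS, hR]
  simp_rw [triSum_last n]
  rw [triSum_last m]
  have e : ∀ i1 i2 : Fin m, (if i1 ≠ i2 then ((n : ℝ) - 2) * (∑ j1 : Fin n, ∑ j2 : Fin n,
            if j1 ≠ j2 then hCvM (x i1) (x i2) (y j1) (y j2) else 0) else 0)
      = ((n : ℝ) - 2) * (if i1 ≠ i2 then (∑ j1 : Fin n, ∑ j2 : Fin n,
            if j1 ≠ j2 then hCvM (x i1) (x i2) (y j1) (y j2) else 0) else 0) := by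
    intro i1 i2
    rw [mul_ite, mul_zero]
  simp_rw [e, ← Finset.mul_sum]
  have hm' : (3 : ℝ) ≤ m := by exact_mod_cast hm
  have hn' : (3 : ℝ) ≤ n := by exact_mod_cast hn
  have m0 : (m : ℝ) ≠ 0 := by linarith
  have m1 : (m : ℝ) - 1 ≠ 0 := by linarith
  have m2 : (m : ℝ) - 2 ≠ 0 := by linarith
  have n0 : (n : ℝ) ≠ 0 := by linarith
  have n1 : (n : ℝ) - 1 ≠ 0 := by linarith
  have n2 : (n : ℝ) - 2 ≠ 0 := by linarith
  field_simp
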